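/- arXiv:2004.09543 — 2 statements merged into one kernel-verified Lean document; each statement's English description precedes it below -/
import Mathlib

section
/- Let g : (Fin 4 → ℝ) → Matrix (Fin 4) (Fin 4) ℝ be twice continuously differentiable, with (g x)ᵀ = g x and g x invertible for every x, and let G x := (g x)⁻¹. Fix x, and write D μ ν ρ for the partial derivative in the μ-th coordinate direction of the (ν,ρ)-entry of g at x, and D2 μ ν ρ σ for the second partial derivative in the μ-th then ν-th coordinate directions of the (ρ,σ)-entry of g at x. Define the Christoffel symbols Γ : (Fin 4 → ℝ) → Fin 4 → Fin 4 → Fin 4 → ℝ by Γ y ρ μ ν := (1/2) Σ_σ (G y) ρ σ * (∂_μ g_{σν}(y) + ∂_ν g_{μσ}(y) − ∂_σ g_{μν}(y)). Then R^{∂Γ} := Σ_{μ,ν,σ} (G x) ν σ * (∂_μ (Γ · μ ν σ)(x) − ∂_ν (Γ · μ μ σ)(x)) equals Σ_{μ,ρ,ν,σ} (G x) μ ρ * (G x) ν σ * (D2 μ ν ρ σ − D2 μ ρ ν σ) + Σ_{μ,ρ,ν,σ,κ,λ} (G x) μ ρ * (G x) ν σ * (G x) κ λ * ( D μ ρ κ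 * ((1/2)·D λ ν σ − D ν λ σ) + (1/2)·D ν μ κ * D σ ρ λ ). -/
open BigOperators Matrix

attribute [local instance] Matrix.normedAddCommGroup Matrix.normedSpace

/-- The partial derivative of `f : (Fin 4 → ℝ) → ℝ` in the `μ`-th coordinate direction
at `x`. -/
noncomputable def pd (f : (Fin 4 → ℝ) → ℝ) (μ : Fin 4) (x : Fin 4 → ℝ) : ℝ :=
  fderiv ℝ f x (Pi.single μ 1)

lemma sum_six_reorder {ι : Type*} [Fintype ι] (F : ι → ι → ι → ι → ι → ι → ℝ) :
    ∑ a, ∑ b, ∑ c, ∑ d, ∑ e, ∑ f, F a b c d e f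
      = ∑ c, ∑ d, ∑ a, ∑ f, ∑ b, ∑ e, F a b c d e f := by
  simp only [← Fintype.sum_prod_type']
  exact Fintype.sum_equiv
    ⟨fun p => (p.2.2.1, p.2.2.2.1, p.1, p.2.2.2.2.2, p.2.1, p.2.2.2.2.1),
      fun q => (q.2.2.1, q.2.2.2.2.1, q.1, q.2.1, q.2.2.2.2.2, q.2.2.2.1),
      fun _ => rfl, fun _ => rfl⟩ _ _ fun _ => rfl

lemma sum_six_reorder' {ι : Type*} [Fintype ι] (F : ι → ι → ι → ι → ι → ι → ℝ) :
    ∑ a, ∑ b, ∑ c, ∑ d, ∑ e, ∑ f, F a b c d e f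
      = ∑ c, ∑ d, ∑ b, ∑ f, ∑ a, ∑ e, F a b c d e f := by
  rw [Finset.sum_comm, sum_six_reorder fun b a c d e f => F a b c d e f]

lemma sum_four_reorder {ι : Type*} [Fintype ι] (F : ι → ι → ι → ι → ℝ) :
    ∑ a, ∑ b, ∑ c, ∑ d, F a b c d = ∑ c, ∑ d, ∑ a, ∑ b, F a b c d := by
  simp only [← Fintype.sum_prod_type']
  exact Fintype.sum_equiv
    ⟨fun p => (p.2.2.1, p.2.2.2, p.1, p.2.1), fun q => (q.2.2.1, q.2.2.2, q.1, q.2.1),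
      fun _ => rfl, fun _ => rfl⟩ _ _ fun _ => rfl

/-- The contraction identity behind `ricci_scalar_derivative_part`, with the metric, its inverse
and their derivatives at a point replaced by arrays of real numbers. -/
lemma ricci_derivative_contraction {ι : Type*} [Fintype ι] (G : ι → ι → ℝ)
    (D dG : ι → ι → ι → ℝ) (D2 : ι → ι → ι → ι → ℝ)
    (hG : ∀ a b, G a b = G b a) (hD : ∀ a b c, D a b c = D a c b)
    (hD2 : ∀ a b c d, D2 a b c d = D2 a b d c)
    (hdG : ∀ m a b, dG m a b = -∑ α, ∑ β, G a α * D m α β * G β b) :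
    ∑ ν, ∑ σ, G ν σ *
        ((∑ μ, (1 / 2) * ∑ l, (dG μ μ l * (D ν l σ + D σ ν l - D l ν σ)
            + G μ l * (D2 μ ν l σ + D2 μ σ ν l - D2 μ l ν σ)))
          - (1 / 2) * ∑ μ, ∑ l, (dG ν μ l * D σ μ l + G μ l * D2 ν σ μ l))
      = (∑ μ, ∑ ρ, ∑ ν, ∑ σ, G μ ρ * G ν σ * (D2 μ ν ρ σ - D2 μ ρ ν σ))
        + ∑ μ, ∑ ρ, ∑ ν, ∑ σ, ∑ κ, ∑ l, G μ ρ * G ν σ * G κ l *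
            (D μ ρ κ * ((1 / 2) * D l ν σ - D ν l σ) + (1 / 2) * D ν μ κ * D σ ρ l) := by
  have hS1 : ∑ ν, ∑ σ, ∑ μ, ∑ l, G ν σ * (G μ l * D2 μ σ ν l)
      = ∑ ν, ∑ σ, ∑ μ, ∑ l, G ν σ * (G μ l * D2 μ ν l σ) := by
    rw [Finset.sum_comm]
    refine Finset.sum_congr rfl fun ν _ => Finset.sum_congr rfl fun σ _ =>
      Finset.sum_congr rfl fun μ _ => Finset.sum_congr rfl fun l _ => ?_
    rw [hG σ ν, hD2 μ ν σ l]
  have hS2 : ∑ ν, ∑ σ, ∑ μ, ∑ l, G ν σ * (G μ l * D2 ν σ μ l)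
      = ∑ ν, ∑ σ, ∑ μ, ∑ l, G ν σ * (G μ l * D2 μ l ν σ) := by
    rw [sum_four_reorder]
    refine Finset.sum_congr rfl fun ν _ => Finset.sum_congr rfl fun σ _ =>
      Finset.sum_congr rfl fun μ _ => Finset.sum_congr rfl fun l _ => ?_
    ring
  have hH1 : ∑ ν, ∑ σ, ∑ μ, ∑ l, G ν σ * (dG μ μ l * D σ ν l)
      = ∑ ν, ∑ σ, ∑ μ, ∑ l, G ν σ * (dG μ μ l * D ν l σ) := by
    rw [Finset.sum_comm]
    refine Finset.sum_congr rfl fun ν _ => Finset.sum_congr rfl fun σ _ =>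
      Finset.sum_congr rfl fun μ _ => Finset.sum_congr rfl fun l _ => ?_
    rw [hG σ ν, hD ν σ l]
  have hR1 : ∑ μ, ∑ ρ, ∑ ν, ∑ σ, G μ ρ * G ν σ * (D2 μ ν ρ σ - D2 μ ρ ν σ)
      = (∑ ν, ∑ σ, ∑ μ, ∑ l, G ν σ * (G μ l * D2 μ ν l σ))
        - ∑ ν, ∑ σ, ∑ μ, ∑ l, G ν σ * (G μ l * D2 μ l ν σ) := by
    rw [sum_four_reorder]
    simp only [← Finset.sum_sub_distrib]
    refine Finset.sum_congr rfl fun ν _ => Finset.sum_congr rfl fun σ _ =>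
      Finset.sum_congr rfl fun μ _ => Finset.sum_congr rfl fun l _ => ?_
    ring
  have hR2 : ∑ μ, ∑ ρ, ∑ ν, ∑ σ, ∑ κ, ∑ l, G μ ρ * G ν σ * G κ l *
        (D μ ρ κ * ((1 / 2) * D l ν σ - D ν l σ))
      = (∑ ν, ∑ σ, ∑ μ, ∑ l, G ν σ * (dG μ μ l * D ν l σ))
        - (1 / 2) * ∑ ν, ∑ σ, ∑ μ, ∑ l, G ν σ * (dG μ μ l * D l ν σ) := by
    rw [sum_six_reorder]
    simp only [Finset.mul_sum, ← Finset.sum_sub_distrib]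
    refine Finset.sum_congr rfl fun ν _ => Finset.sum_congr rfl fun σ _ =>
      Finset.sum_congr rfl fun μ _ => Finset.sum_congr rfl fun l _ => ?_
    trans (∑ α, ∑ β, G μ α * D μ α β * G β l) * (G ν σ * ((1 / 2) * D l ν σ - D ν l σ))
    · simp only [Finset.sum_mul]
      refine Finset.sum_congr rfl fun α _ => Finset.sum_congr rfl fun β _ => ?_
      ring
    · rw [hdG]
      ring
  have hR3 : ∑ μ, ∑ ρ, ∑ ν, ∑ σ, ∑ κ, ∑ l, G μ ρ * G ν σ * G κ l *
        ((1 / 2) * D ν μ κ * D σ ρ l)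
      = -((1 / 2) * ∑ ν, ∑ σ, ∑ μ, ∑ l, G ν σ * (dG ν μ l * D σ μ l)) := by
    rw [sum_six_reorder']
    simp only [Finset.mul_sum, ← Finset.sum_neg_distrib]
    refine Finset.sum_congr rfl fun ν _ => Finset.sum_congr rfl fun σ _ =>
      Finset.sum_congr rfl fun μ _ => Finset.sum_congr rfl fun l _ => ?_
    trans (∑ α, ∑ β, G μ α * D ν α β * G β l) * (G ν σ * ((1 / 2) * D σ μ l))
    · simp only [Finset.sum_mul]
      refine Finset.sum_congr rfl fun α _ => Finset.sum_congr rfl fun β _ => ?_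
      rw [hG α μ]
      ring
    · rw [hdG]
      ring
  have hL : ∑ ν, ∑ σ, G ν σ *
        ((∑ μ, (1 / 2) * ∑ l, (dG μ μ l * (D ν l σ + D σ ν l - D l ν σ)
            + G μ l * (D2 μ ν l σ + D2 μ σ ν l - D2 μ l ν σ)))
          - (1 / 2) * ∑ μ, ∑ l, (dG ν μ l * D σ μ l + G μ l * D2 ν σ μ l))
      = (1 / 2) * ((∑ ν, ∑ σ, ∑ μ, ∑ l, G ν σ * (dG μ μ l * D ν l σ))
          + (∑ ν, ∑ σ, ∑ μ, ∑ l, G ν σ * (dG μ μ l * D σ ν l))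
          - (∑ ν, ∑ σ, ∑ μ, ∑ l, G ν σ * (dG μ μ l * D l ν σ))
          + (∑ ν, ∑ σ, ∑ μ, ∑ l, G ν σ * (G μ l * D2 μ ν l σ))
          + (∑ ν, ∑ σ, ∑ μ, ∑ l, G ν σ * (G μ l * D2 μ σ ν l))
          - (∑ ν, ∑ σ, ∑ μ, ∑ l, G ν σ * (G μ l * D2 μ l ν σ))
          - (∑ ν, ∑ σ, ∑ μ, ∑ l, G ν σ * (dG ν μ l * D σ μ l))
          - (∑ ν, ∑ σ, ∑ μ, ∑ l, G ν σ * (G μ l * D2 ν σ μ l))) := by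
    simp only [Finset.mul_sum, ← Finset.sum_sub_distrib, ← Finset.sum_add_distrib]
    refine Finset.sum_congr rfl fun ν _ => Finset.sum_congr rfl fun σ _ =>
      Finset.sum_congr rfl fun μ _ => Finset.sum_congr rfl fun l _ => ?_
    ring
  rw [hL, hS1, hS2, hH1, hR1]
  simp only [mul_add _ (D _ _ _ * _), Finset.sum_add_distrib]
  rw [hR2, hR3]
  ring

lemma pd_mul {f h : (Fin 4 → ℝ) → ℝ} {x : Fin 4 → ℝ} (hf : DifferentiableAt ℝ f x)
    (hh : DifferentiableAt ℝ h x) (m : Fin 4) :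
    pd (fun y => f y * h y) m x = pd f m x * h x + f x * pd h m x := by
  simp only [pd, fderiv_fun_mul hf hh, _root_.add_apply, _root_.smul_apply, smul_eq_mul]
  ring

lemma pd_const_mul {f : (Fin 4 → ℝ) → ℝ} {x : Fin 4 → ℝ} (hf : DifferentiableAt ℝ f x)
    (c : ℝ) (m : Fin 4) : pd (fun y => c * f y) m x = c * pd f m x := by
  simp [pd, fderiv_const_mul hf]

lemma pd_add {f h : (Fin 4 → ℝ) → ℝ} {x : Fin 4 → ℝ} (hf : DifferentiableAt ℝ f x)
    (hh : DifferentiableAt ℝ h x) (m : Fin 4) :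
    pd (fun y => f y + h y) m x = pd f m x + pd h m x := by
  simp [pd, fderiv_fun_add hf hh]

lemma pd_sub {f h : (Fin 4 → ℝ) → ℝ} {x : Fin 4 → ℝ} (hf : DifferentiableAt ℝ f x)
    (hh : DifferentiableAt ℝ h x) (m : Fin 4) :
    pd (fun y => f y - h y) m x = pd f m x - pd h m x := by
  simp [pd, fderiv_fun_sub hf hh]

lemma pd_sum {ι : Type*} [Fintype ι] {f : ι → (Fin 4 → ℝ) → ℝ} {x : Fin 4 → ℝ}
    (hf : ∀ i, DifferentiableAt ℝ (f i) x) (m : Fin 4) :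
    pd (fun y => ∑ i, f i y) m x = ∑ i, pd (f i) m x := by
  simp [pd, fderiv_fun_sum fun i _ => hf i]

lemma differentiableAt_pd {f : (Fin 4 → ℝ) → ℝ} (hf : ContDiff ℝ 2 f) (m : Fin 4)
    (x : Fin 4 → ℝ) : DifferentiableAt ℝ (pd f m) x :=
  (((hf.fderiv_right (m := 1) (by norm_num)).differentiable one_ne_zero).clm_apply
    (differentiable_const _)).differentiableAt

lemma differentiable_det {n : Type*} [Fintype n] [DecidableEq n]
    {A : (Fin 4 → ℝ) → Matrix n n ℝ} (hA : ∀ i j, Differentiable ℝ fun y => A y i j) :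
    Differentiable ℝ fun y => (A y).det := by
  simp only [Matrix.det_apply']
  fun_prop

lemma differentiable_inv_entry {n : Type*} [Fintype n] [DecidableEq n]
    {A : (Fin 4 → ℝ) → Matrix n n ℝ} (hA : ∀ i j, Differentiable ℝ fun y => A y i j)
    (hunit : ∀ y, IsUnit (A y)) (i j : n) : Differentiable ℝ fun y => (A y)⁻¹ i j := by
  have hadj : Differentiable ℝ fun y => (A y).adjugate i j := by
    simp only [Matrix.adjugate_apply]
    refine differentiable_det fun k l => ?_
    simp only [Matrix.updateRow_apply]
    split_ifs
    · exact differentiable_const _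
    · exact hA k l
  simp only [Matrix.inv_def, Matrix.smul_apply, smul_eq_mul, Ring.inverse_eq_inv']
  exact ((differentiable_det hA).inv fun y =>
    ((Matrix.isUnit_iff_isUnit_det _).1 (hunit y)).ne_zero).mul hadj

/-- The entrywise form of `∂(A⁻¹) = -A⁻¹ (∂A) A⁻¹`. -/
lemma pd_inv_entry {n : Type*} [Fintype n] [DecidableEq n]
    {A : (Fin 4 → ℝ) → Matrix n n ℝ} (hA : ∀ i j, Differentiable ℝ fun y => A y i j)
    (hunit : ∀ y, IsUnit (A y)) (x : Fin 4 → ℝ) (m : Fin 4) (i j : n) :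
    pd (fun y => (A y)⁻¹ i j) m x
      = -∑ k, ∑ l, (A x)⁻¹ i k * pd (fun y => A y k l) m x * (A x)⁻¹ l j := by
  have hI := differentiable_inv_entry hA hunit
  have hdet : ∀ y, IsUnit (A y).det := fun y => (Matrix.isUnit_iff_isUnit_det _).1 (hunit y)
  let dA : Matrix n n ℝ := Matrix.of fun k l => pd (fun y => A y k l) m x
  let dI : Matrix n n ℝ := Matrix.of fun k l => pd (fun y => (A y)⁻¹ k l) m x
  have hprod : dI * A x + (A x)⁻¹ * dA = 0 := by
    ext a c
    have hconst : (fun y => ∑ b, (A y)⁻¹ a b * A y b c) = fun _ => (1 : Matrix n n ℝ) a c := by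
      funext y
      rw [← Matrix.mul_apply, Matrix.nonsing_inv_mul _ (hdet y)]
    have h0 : pd (fun y => ∑ b, (A y)⁻¹ a b * A y b c) m x = 0 := by
      rw [hconst]
      simp [pd]
    rw [pd_sum fun b => ((hI a b).fun_mul (hA b c)).differentiableAt] at h0
    simp only [pd_mul (hI a _).differentiableAt (hA _ c).differentiableAt,
      Finset.sum_add_distrib] at h0
    simpa [Matrix.mul_apply, dA, dI] using h0
  have hdI : dI = -((A x)⁻¹ * dA * (A x)⁻¹) := by
    rw [← Matrix.mul_nonsing_inv_cancel_right (A x) dI (hdet x), eq_neg_of_add_eq_zero_left hprod,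
      Matrix.neg_mul]
  change dI i j = _
  rw [hdI, Matrix.neg_apply, Matrix.mul_assoc, Matrix.mul_apply]
  simp only [Matrix.mul_apply, Finset.mul_sum, mul_assoc, dA, Matrix.of_apply]

/-- The derivative part `R^{∂Γ} = g^{νσ}(∂_μ Γ^μ_{νσ} − ∂_ν Γ^μ_{μσ})` of the Ricci scalar
expressed purely via partial derivatives of the metric and its inverse. -/
theorem ricci_scalar_derivative_part
    (g : (Fin 4 → ℝ) → Matrix (Fin 4) (Fin 4) ℝ)
    (hg : ContDiff ℝ 2 g)
    (hsymm : ∀ x, (g x)ᵀ = g x)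
    (hunit : ∀ x, IsUnit (g x))
    (G : (Fin 4 → ℝ) → Matrix (Fin 4) (Fin 4) ℝ)
    (hG : ∀ x, G x = (g x)⁻¹)
    (x : Fin 4 → ℝ)
    (D : Fin 4 → Fin 4 → Fin 4 → ℝ)
    (hD : ∀ μ ν ρ, D μ ν ρ = pd (fun y => g y ν ρ) μ x)
    (D2 : Fin 4 → Fin 4 → Fin 4 → Fin 4 → ℝ)
    (hD2 : ∀ μ ν ρ σ, D2 μ ν ρ σ = pd (pd (fun y => g y ρ σ) ν) μ x)
    (Γ : (Fin 4 → ℝ) → Fin 4 → Fin 4 → Fin 4 → ℝ)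
    (hΓ : ∀ y ρ μ ν, Γ y ρ μ ν = (1 / 2) * ∑ σ, G y ρ σ *
      (pd (fun z => g z σ ν) μ y + pd (fun z => g z μ σ) ν y - pd (fun z => g z μ ν) σ y)) :
    ∑ ν, ∑ σ, G x ν σ *
        ((∑ μ, pd (fun y => Γ y μ ν σ) μ x) - (∑ μ, pd (fun y => Γ y μ μ σ) ν x))
      = (∑ μ, ∑ ρ, ∑ ν, ∑ σ, G x μ ρ * G x ν σ * (D2 μ ν ρ σ - D2 μ ρ ν σ))
        + ∑ μ, ∑ ρ, ∑ ν, ∑ σ, ∑ κ, ∑ lam, G x μ ρ * G x ν σ * G x κ lam *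
            (D μ ρ κ * ((1 / 2) * D lam ν σ - D ν lam σ)
              + (1 / 2) * D ν μ κ * D σ ρ lam) := by
  obtain rfl : G = fun y => (g y)⁻¹ := funext hG
  beta_reduce at hΓ ⊢
  have hgE : ∀ i j, ContDiff ℝ 2 fun y => g y i j := fun i j =>
    contDiff_pi.1 (contDiff_pi.1 hg i) j
  have hgD : ∀ i j, Differentiable ℝ fun y => g y i j := fun i j =>
    (hgE i j).differentiable two_ne_zero
  have hI : ∀ i j, DifferentiableAt ℝ (fun y => (g y)⁻¹ i j) x := fun i j =>
    (differentiable_inv_entry hgD hunit i j).differentiableAt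
  have hP : ∀ m i j, DifferentiableAt ℝ (pd (fun y => g y i j) m) x := fun m i j =>
    differentiableAt_pd (hgE i j) m x
  have hg_symm : ∀ i j, (fun y => g y i j) = fun y => g y j i := fun i j =>
    funext fun y => congrFun (congrFun (hsymm y) j) i
  have hI_symm : ∀ y i j, (g y)⁻¹ i j = (g y)⁻¹ j i := fun y i j => by
    rw [← Matrix.transpose_apply (g y)⁻¹, Matrix.transpose_nonsing_inv, hsymm]
  have hΓ_diff : ∀ ρ μ ν, DifferentiableAt ℝ (fun y => Γ y ρ μ ν) x := fun ρ μ ν => by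
    simp only [hΓ]
    exact (DifferentiableAt.fun_sum fun s _ => (hI ρ s).mul
      (((hP μ s ν).add (hP ν μ s)).sub (hP s μ ν))).const_mul _
  have hΓ_pd : ∀ m ρ μ ν, pd (fun y => Γ y ρ μ ν) m x = (1 / 2) * ∑ s,
      (pd (fun y => (g y)⁻¹ ρ s) m x * (D μ s ν + D ν μ s - D s μ ν)
        + (g x)⁻¹ ρ s * (D2 m μ s ν + D2 m ν μ s - D2 m s μ ν)) := fun m ρ μ ν => by
    have hE : ∀ s, DifferentiableAt ℝ (fun y => pd (fun z => g z s ν) μ y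
        + pd (fun z => g z μ s) ν y - pd (fun z => g z μ ν) s y) x := fun s =>
      ((hP μ s ν).add (hP ν μ s)).sub (hP s μ ν)
    simp only [hΓ]
    rw [pd_const_mul (DifferentiableAt.fun_sum fun s _ => (hI ρ s).fun_mul (hE s)),
      pd_sum fun s => (hI ρ s).fun_mul (hE s)]
    congr 1
    refine Finset.sum_congr rfl fun s _ => ?_
    rw [pd_mul (hI ρ s) (hE s), pd_sub ((hP μ s ν).fun_add (hP ν μ s)) (hP s μ ν),
      pd_add (hP μ s ν) (hP ν μ s)]
    simp only [hD, hD2]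
  have hΓ_trace : ∀ y σ, ∑ μ, Γ y μ μ σ
      = (1 / 2) * ∑ μ, ∑ l, (g y)⁻¹ μ l * pd (fun z => g z μ l) σ y := fun y σ => by
    have hswap : ∑ μ, ∑ l, (g y)⁻¹ μ l * pd (fun z => g z l σ) μ y
        = ∑ μ, ∑ l, (g y)⁻¹ μ l * pd (fun z => g z μ σ) l y := by
      rw [Finset.sum_comm]
      refine Finset.sum_congr rfl fun μ _ => Finset.sum_congr rfl fun l _ => ?_
      rw [hI_symm]
    simp only [hΓ, mul_add, mul_sub, ← Finset.mul_sum, Finset.sum_add_distrib,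
      Finset.sum_sub_distrib, hswap]
    ring
  have hΓ_trace_pd : ∀ ν σ, ∑ μ, pd (fun y => Γ y μ μ σ) ν x
      = (1 / 2) * ∑ μ, ∑ l, (pd (fun y => (g y)⁻¹ μ l) ν x * D σ μ l
        + (g x)⁻¹ μ l * D2 ν σ μ l) := fun ν σ => by
    rw [← pd_sum fun μ => hΓ_diff μ μ σ]
    simp only [hΓ_trace]
    have hT : ∀ μ l, DifferentiableAt ℝ
        (fun y => (g y)⁻¹ μ l * pd (fun z => g z μ l) σ y) x := fun μ l =>
      (hI μ l).mul (hP σ μ l)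
    have hT' : ∀ μ, DifferentiableAt ℝ
        (fun y => ∑ l, (g y)⁻¹ μ l * pd (fun z => g z μ l) σ y) x := fun μ =>
      DifferentiableAt.fun_sum fun l _ => hT μ l
    rw [pd_const_mul (DifferentiableAt.fun_sum fun μ _ => hT' μ), pd_sum hT']
    congr 1
    refine Finset.sum_congr rfl fun μ _ => ?_
    rw [pd_sum (hT μ)]
    refine Finset.sum_congr rfl fun l _ => ?_
    rw [pd_mul (hI μ l) (hP σ μ l), hD, hD2]
  simp only [hΓ_trace_pd]
  simp only [hΓ_pd]
  refine ricci_derivative_contraction _ D (fun m a b => pd (fun y => (g y)⁻¹ a b) m x) D2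
    (hI_symm x) (fun a b c => ?_) (fun a b c d => ?_) fun m a b => ?_
  · rw [hD, hD, hg_symm]
  · rw [hD2, hD2, hg_symm]
  · simp only [hD]
    exact pd_inv_entry hgD hunit x m a b
end

section
/- Let η be the Minkowski metric, let h ∈ Matrix (Fin 4) (Fin 4) ℝ with hᵀ = h, and let κ : ℝ. Then −det(η + κ • h) = 1 + a + b + c + d, where, writing t₁ := trace(η * h), t₂ := trace((η * h)^2), t₃ := trace((η * h)^3), t₄ := trace((η * h)^4): a := κ * t₁, b := κ^2 * ((1/2)·t₁^2 − (1/2)·t₂), c := κ^3 * ((1/6)·t₁^3 − (1/2)·t₁·t₂ + (1/3)·t₃), and d := κ^4 * ((1/24)·t₁^4 − (1/4)·t₁^2·t₂ + (1/3)·t₁·t₃ + (1/8)·t₂^2 − (1/4)·t₄). -/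
open BigOperators Matrix

/-- The Minkowski metric `diag(1, -1, -1, -1)`. -/
noncomputable def minkowski : Matrix (Fin 4) (Fin 4) ℝ :=
  Matrix.diagonal ![1, -1, -1, -1]

theorem minkowski_mul_self : minkowski * minkowski = 1 := by
  rw [minkowski, Matrix.diagonal_mul_diagonal, ← Matrix.diagonal_one]
  congr 1
  ext i
  fin_cases i <;> simp

theorem det_minkowski : minkowski.det = -1 := by
  simp [minkowski, Matrix.det_diagonal, Fin.prod_univ_four]

/-- The expansion of `det (1 + M)` in traces of powers of a `4 × 4` matrix `M`, with
denominators cleared. -/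
theorem Matrix.det_one_add_fin_four {R : Type*} [CommRing R] (M : Matrix (Fin 4) (Fin 4) R) :
    24 * (1 + M).det = 24 + 24 * M.trace + 12 * (M.trace ^ 2 - (M ^ 2).trace)
      + 4 * (M.trace ^ 3 - 3 * M.trace * (M ^ 2).trace + 2 * (M ^ 3).trace)
      + (M.trace ^ 4 - 6 * M.trace ^ 2 * (M ^ 2).trace + 8 * M.trace * (M ^ 3).trace
        + 3 * (M ^ 2).trace ^ 2 - 6 * (M ^ 4).trace) := by
  simp only [pow_succ M, pow_zero, one_mul, Matrix.det_succ_row_zero, Matrix.trace,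
    Matrix.diag_apply, Matrix.mul_apply, Fin.sum_univ_succ, Matrix.submatrix_apply]
  simp [Fin.succAbove, Matrix.one_apply]
  ring

/-- The determinant of the metric `g = η + κ h` as a polynomial in traces of powers
of `η h`, graded by powers of the gravitational coupling constant `κ`. -/
theorem det_metric_trace_expansion
    (h : Matrix (Fin 4) (Fin 4) ℝ) (hsymm : hᵀ = h) (κ : ℝ)
    (t₁ t₂ t₃ t₄ : ℝ)
    (ht₁ : t₁ = Matrix.trace (minkowski * h))
    (ht₂ : t₂ = Matrix.trace ((minkowski * h) ^ 2))
    (ht₃ : t₃ = Matrix.trace ((minkowski * h) ^ 3))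
    (ht₄ : t₄ = Matrix.trace ((minkowski * h) ^ 4))
    (a b c d : ℝ)
    (ha : a = κ * t₁)
    (hb : b = κ ^ 2 * ((1 / 2) * t₁ ^ 2 - (1 / 2) * t₂))
    (hc : c = κ ^ 3 * ((1 / 6) * t₁ ^ 3 - (1 / 2) * t₁ * t₂ + (1 / 3) * t₃))
    (hd : d = κ ^ 4 * ((1 / 24) * t₁ ^ 4 - (1 / 4) * t₁ ^ 2 * t₂ + (1 / 3) * t₁ * t₃
      + (1 / 8) * t₂ ^ 2 - (1 / 4) * t₄)) :
    -(minkowski + κ • h).det = 1 + a + b + c + d := by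
  have hfac : minkowski + κ • h = minkowski * (1 + κ • (minkowski * h)) := by
    rw [mul_add, mul_one, Matrix.mul_smul, ← mul_assoc, minkowski_mul_self, one_mul]
  have hdet := Matrix.det_one_add_fin_four (κ • (minkowski * h))
  simp only [smul_pow, Matrix.trace_smul, smul_eq_mul, ← ht₁, ← ht₂, ← ht₃, ← ht₄] at hdet
  rw [hfac, Matrix.det_mul, det_minkowski, ha, hb, hc, hd]
  linear_combination hdet / 24
end
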